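/- Let 𝒫 be pre-Hahn-localizable on (Ω, ℱ) with strictly disjointly supported localization 𝒬 (supports S_Q pairwise disjoint), and let H be the Hahn extension of ℱ. For P ∈ 𝒫 let P^𝒬 be its extension to H given by P^𝒬(A) = ∑_{Q∈𝒬(P)} P(A ∩ S_Q), and for Q ∈ 𝒬 let Q^𝒬(A) = Q(A ∩ S_Q), for A ∈ H. Then 𝒫^𝒬 = {P^𝒬 : P ∈ 𝒫} is Hahn-localizable on (Ω, H) with localization 𝒬^𝒬 = {Q^𝒬 : Q ∈ 𝒬} and the same support sets S_Q; in particular: (i) Q^𝒬(S_R) = 1 if Q = R and = 0 otherwise; (ii) 𝒬^𝒬 ⋘ 𝒫^𝒬 ⋘ sconv(𝒬^𝒬); and (iii) every family {E_Q}_{Q∈𝒬} with E_Q ∈ H, E_Q ⊆ S_Q has the essential supremum E = ⋃_{Q∈𝒬} E_Q ∈ H, i.e. Q^𝒬(E_Q \ E) = 0 for all Q, and whenever F ∈ H satisfies Q^𝒬(E_Q \ F) = 0 for all Q ∈ 𝒬, then Q^𝒬(E \ F) = 0 for all Q ∈ 𝒬. -/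

import Mathlib

open MeasureTheory Set
open scoped ENNReal

variable {Ω : Type*}

/-- Application of a measure w.r.t. an explicitly given σ-algebra. -/
def mApply (m' : MeasurableSpace Ω) (ρ : @Measure Ω m') : Set Ω → ℝ≥0∞ := fun A => ρ A

/-- Application of a signed measure w.r.t. an explicitly given σ-algebra. -/
noncomputable def smApply (m' : MeasurableSpace Ω) (ν : @SignedMeasure Ω m') : Set Ω → ℝ :=
  fun A => ν A

/-- Total variation measure of a signed measure w.r.t. an explicitly given σ-algebra. -/
noncomputable def tvM (m' : MeasurableSpace Ω) (ν : @SignedMeasure Ω m') : @Measure Ω m' :=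
  @SignedMeasure.totalVariation Ω m' ν

/-- `Q ⋘ P`: every element of `Q` is absolutely continuous w.r.t. some element of `P`. -/
def Lll [MeasurableSpace Ω] (Q P : Set (Measure Ω)) : Prop :=
  ∀ q ∈ Q, ∃ p ∈ P, q ≪ p

/-- The σ-convex hull of a family of measures. -/
def sconv [MeasurableSpace Ω] (Q : Set (Measure Ω)) : Set (Measure Ω) :=
  {μ | ∃ (f : ℕ → Measure Ω) (l : ℕ → ℝ≥0∞), (∀ k, f k ∈ Q) ∧ (∑' k, l k) = 1 ∧
    μ = Measure.sum fun k => l k • f k}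

/-- `P` is pre-Hahn-localizable with localization `Q` and supports `S`. -/
structure IsPreHahnLoc [MeasurableSpace Ω] (P Q : Set (Measure Ω))
    (S : Measure Ω → Set Ω) : Prop where
  probP : ∀ p ∈ P, IsProbabilityMeasure p
  probQ : ∀ q ∈ Q, IsProbabilityMeasure q
  measS : ∀ q ∈ Q, MeasurableSet (S q)
  self : ∀ q ∈ Q, q (S q) = 1
  other : ∀ q ∈ Q, ∀ r ∈ Q, q ≠ r → q (S r) = 0
  qp : Lll Q P
  ps : Lll P (sconv Q)

/-- The Hahn extension of the σ-algebra: generated by `ℱ` together with all sets of the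
form `⋃_{q ∈ Q} E_q` with `E_q ∈ ℱ` and `E_q ⊆ S q`. -/
def hahnExt [m : MeasurableSpace Ω] (Q : Set (Measure Ω)) (S : Measure Ω → Set Ω) :
    MeasurableSpace Ω :=
  m ⊔ MeasurableSpace.generateFrom
    {A | ∃ E : Measure Ω → Set Ω, (∀ q ∈ Q, MeasurableSet[m] (E q) ∧ E q ⊆ S q) ∧
      A = ⋃ q ∈ Q, E q}


/-- `⋘` for families of measures on an explicitly given σ-algebra. -/
def Lll' (m' : MeasurableSpace Ω) (Q P : Set (@Measure Ω m')) : Prop :=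
  ∀ q ∈ Q, ∃ p ∈ P, q ≪ p

/-- σ-convex hull for families of measures on an explicitly given σ-algebra. -/
def sconv' (m' : MeasurableSpace Ω) (Q : Set (@Measure Ω m')) : Set (@Measure Ω m') :=
  {μ | ∃ (f : ℕ → @Measure Ω m') (l : ℕ → ℝ≥0∞), (∀ k, f k ∈ Q) ∧ (∑' k, l k) = 1 ∧
    μ = @Measure.sum Ω ℕ m' fun k => l k • f k}

section HahnExtension

theorem le_hahnExt [m : MeasurableSpace Ω] (Q : Set (Measure Ω)) (S : Measure Ω → Set Ω) :
    m ≤ hahnExt Q S :=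
  le_sup_left

theorem biUnion_inter_of_disjoint {ι : Type*} {Q : Set ι} {S E : ι → Set Ω}
    (hdisj : ∀ q ∈ Q, ∀ r ∈ Q, q ≠ r → Disjoint (S q) (S r)) (hE : ∀ q ∈ Q, E q ⊆ S q)
    {q : ι} (hq : q ∈ Q) : (⋃ r ∈ Q, E r) ∩ S q = E q := by
  ext x
  simp only [mem_inter_iff, mem_iUnion, exists_prop]
  refine ⟨?_, fun hx => ⟨⟨q, hq, hx⟩, hE q hq hx⟩⟩
  rintro ⟨⟨r, hr, hxr⟩, hxq⟩
  by_cases h : q = r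
  · exact h ▸ hxr
  · exact ((Set.disjoint_left.mp (hdisj q hq r hr h)) hxq (hE r hr hxr)).elim

/-- The trace of the Hahn extension on a support is the trace of the original σ-algebra. -/
theorem measurableSet_inter_support [m : MeasurableSpace Ω] {Q : Set (Measure Ω)}
    {S : Measure Ω → Set Ω} (hS : ∀ q ∈ Q, MeasurableSet (S q))
    (hdisj : ∀ q ∈ Q, ∀ r ∈ Q, q ≠ r → Disjoint (S q) (S r)) {A : Set Ω}
    (hA : MeasurableSet[hahnExt Q S] A) {q : Measure Ω} (hq : q ∈ Q) :
    MeasurableSet (A ∩ S q) := by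
  have hle : hahnExt Q S ≤ (m.comap ((↑) : S q → Ω)).map ((↑) : S q → Ω) := by
    refine sup_le (fun B hB => ⟨B, hB, rfl⟩) (MeasurableSpace.generateFrom_le ?_)
    rintro _ ⟨E, hE, rfl⟩
    refine ⟨E q, (hE q hq).1, ?_⟩
    rw [Subtype.preimage_val_eq_preimage_val_iff, inter_comm, inter_comm (S q),
      biUnion_inter_of_disjoint hdisj (fun r hr => (hE r hr).2) hq,
      inter_eq_left.mpr (hE q hq).2]
  obtain ⟨B, hB, hBA⟩ := hle A hA
  rw [Subtype.preimage_val_eq_preimage_val_iff, inter_comm, inter_comm (S q)] at hBA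
  exact hBA ▸ hB.inter (hS q hq)

theorem measurableSet_hahnExt_biUnion [m : MeasurableSpace Ω] {Q : Set (Measure Ω)}
    {S E : Measure Ω → Set Ω} (hE : ∀ q ∈ Q, MeasurableSet (E q) ∧ E q ⊆ S q) :
    MeasurableSet[hahnExt Q S] (⋃ q ∈ Q, E q) :=
  (le_sup_right : _ ≤ hahnExt Q S) _ (MeasurableSpace.measurableSet_generateFrom ⟨E, hE, rfl⟩)

/-- A probability measure dominated by a countable convex combination of the localizing measures
is carried by the countably many supports it charges. -/
theorem IsPreHahnLoc.tsum_measure_support [MeasurableSpace Ω] {P Q : Set (Measure Ω)}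
    {S : Measure Ω → Set Ω} (hpre : IsPreHahnLoc P Q S)
    (hdisj : ∀ q ∈ Q, ∀ r ∈ Q, q ≠ r → Disjoint (S q) (S r)) {p : Measure Ω} (hp : p ∈ P) :
    ∑' q : {q // q ∈ Q ∧ 0 < p (S q)}, p (S q.1) = 1 := by
  obtain ⟨_, ⟨f, l, hf, -, rfl⟩, hac⟩ := hpre.ps p hp
  have := hpre.probP p hp
  have hsub : {q | q ∈ Q ∧ 0 < p (S q)} ⊆ range f := by
    rintro q ⟨hq, hpos⟩
    by_contra hne
    refine hpos.ne' (hac ?_)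
    refine Measure.sum_apply_eq_zero.mpr fun k => ?_
    rw [Measure.smul_apply, hpre.other (f k) (hf k) q hq fun h => hne ⟨k, h⟩, smul_zero]
  have hcount : Countable {q // q ∈ Q ∧ 0 < p (S q)} := ((countable_range f).mono hsub).to_subtype
  have hfull : p (⋃ k, S (f k))ᶜ = 0 := by
    refine hac (Measure.sum_apply_eq_zero.mpr fun k => ?_)
    have := hpre.probQ _ (hf k)
    have hk : f k (S (f k))ᶜ = 0 :=
      (prob_compl_eq_zero_iff (hpre.measS _ (hf k))).mpr (hpre.self _ (hf k))
    rw [Measure.smul_apply,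
      measure_mono_null (compl_subset_compl.mpr (subset_iUnion (fun k => S (f k)) k)) hk,
      smul_zero]
  have hcarrier : p (⋃ q : {q // q ∈ Q ∧ 0 < p (S q)}, S q.1)ᶜ = 0 := by
    refine measure_mono_null (t := (⋃ k, S (f k))ᶜ ∪
      ⋃ k, S (f k) \ ⋃ q : {q // q ∈ Q ∧ 0 < p (S q)}, S q.1) ?_
      (measure_union_null hfull (measure_iUnion_null fun k => ?_))
    · intro x hx
      by_cases h : x ∈ ⋃ k, S (f k)
      · obtain ⟨k, hk⟩ := mem_iUnion.mp h
        exact Or.inr (mem_iUnion.mpr ⟨k, hk, hx⟩)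
      · exact Or.inl h
    · rcases eq_zero_or_pos (p (S (f k))) with h0 | hpos
      · exact measure_mono_null sdiff_subset h0
      · rw [sdiff_eq_empty.mpr
          (subset_iUnion (fun q : {q // q ∈ Q ∧ 0 < p (S q)} => S q.1) ⟨f k, hf k, hpos⟩),
          measure_empty]
  have hmeas : ∀ q : {q // q ∈ Q ∧ 0 < p (S q)}, MeasurableSet (S q.1) :=
    fun q => hpre.measS _ q.2.1
  rw [← measure_iUnion (fun q r hqr => hdisj _ q.2.1 _ r.2.1 (Subtype.coe_injective.ne hqr)) hmeas]
  exact (prob_compl_eq_zero_iff (MeasurableSet.iUnion hmeas)).mp hcarrier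

end HahnExtension

/-- The extensions `P^Q = {P^Q : P ∈ P}` and `Q^Q = {Q^Q : Q ∈ Q}` to the
Hahn extension `H`, given by `P^Q(A) = ∑_{q ∈ Q(P)} P(A ∩ S q)` and `Q^Q(A) = Q(A ∩ S_Q)`,
form a Hahn-localizable model on `(Ω, H)` with the same support sets: (i) `Q^Q(S_R) = δ_{QR}`;
(ii) `Q^Q ⋘ P^Q ⋘ sconv(Q^Q)`; (iii) every family `{E_q}` of `H`-sets with `E_q ⊆ S q` has
`⋃_q E_q ∈ H` as essential supremum. -/
theorem stmt14 [m : MeasurableSpace Ω] (P Q : Set (Measure Ω)) (S : Measure Ω → Set Ω)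
    (hpre : IsPreHahnLoc P Q S)
    (hdisj : ∀ q ∈ Q, ∀ r ∈ Q, q ≠ r → Disjoint (S q) (S r))
    (extP extQ : Measure Ω → @Measure Ω (hahnExt Q S))
    (hextP : ∀ p ∈ P, ∀ A : Set Ω, MeasurableSet[hahnExt Q S] A →
      mApply (hahnExt Q S) (extP p) A = ∑' q : {q // q ∈ Q ∧ 0 < p (S q)}, p (A ∩ S q.1))
    (hextQ : ∀ q ∈ Q, ∀ A : Set Ω, MeasurableSet[hahnExt Q S] A →
      mApply (hahnExt Q S) (extQ q) A = q (A ∩ S q)) :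
    (∀ p ∈ P, IsProbabilityMeasure (extP p)) ∧
    (∀ q ∈ Q, IsProbabilityMeasure (extQ q)) ∧
    (∀ q ∈ Q, mApply (hahnExt Q S) (extQ q) (S q) = 1) ∧
    (∀ q ∈ Q, ∀ r ∈ Q, q ≠ r → mApply (hahnExt Q S) (extQ q) (S r) = 0) ∧
    Lll' (hahnExt Q S) (extQ '' Q) (extP '' P) ∧
    Lll' (hahnExt Q S) (extP '' P) (sconv' (hahnExt Q S) (extQ '' Q)) ∧
    (∀ E : Measure Ω → Set Ω,
      (∀ q ∈ Q, MeasurableSet[hahnExt Q S] (E q) ∧ E q ⊆ S q) →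
      MeasurableSet[hahnExt Q S] (⋃ q ∈ Q, E q) ∧
      (∀ q ∈ Q, mApply (hahnExt Q S) (extQ q) (E q \ ⋃ r ∈ Q, E r) = 0) ∧
      ∀ F : Set Ω, MeasurableSet[hahnExt Q S] F →
        (∀ q ∈ Q, mApply (hahnExt Q S) (extQ q) (E q \ F) = 0) →
        ∀ q ∈ Q, mApply (hahnExt Q S) (extQ q) ((⋃ r ∈ Q, E r) \ F) = 0) := by
  have hmS : ∀ q ∈ Q, MeasurableSet[hahnExt Q S] (S q) := fun q hq =>
    le_hahnExt Q S _ (hpre.measS q hq)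
  have hU : ∀ E : Measure Ω → Set Ω, (∀ q ∈ Q, MeasurableSet[hahnExt Q S] (E q) ∧ E q ⊆ S q) →
      MeasurableSet[hahnExt Q S] (⋃ q ∈ Q, E q) := by
    refine fun E hE => measurableSet_hahnExt_biUnion fun q hq => ⟨?_, (hE q hq).2⟩
    rw [← inter_eq_left.mpr (hE q hq).2]
    exact measurableSet_inter_support hpre.measS hdisj (hE q hq).1 hq
  refine ⟨fun p hp => ⟨?_⟩, fun q hq => ⟨?_⟩, fun q hq => ?_, fun q hq r hr hqr => ?_, ?_, ?_,
    fun E hE => ⟨?_, fun q hq => ?_, fun F hF hEF q hq => ?_⟩⟩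
  · refine (hextP p hp univ MeasurableSet.univ).trans ?_
    simpa only [univ_inter] using hpre.tsum_measure_support hdisj hp
  · refine (hextQ q hq univ MeasurableSet.univ).trans ?_
    rw [univ_inter, hpre.self q hq]
  · rw [hextQ q hq _ (hmS q hq), inter_self, hpre.self q hq]
  · rw [hextQ q hq _ (hmS r hr)]
    exact measure_mono_null inter_subset_left (hpre.other q hq r hr hqr)
  · rintro _ ⟨q, hq, rfl⟩
    obtain ⟨p, hp, hqp⟩ := hpre.qp q hq
    refine ⟨extP p, ⟨p, hp, rfl⟩, Measure.AbsolutelyContinuous.mk fun A hA h0 => ?_⟩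
    refine (hextQ q hq A hA).trans (hqp ?_)
    have hpos : 0 < p (S q) := pos_iff_ne_zero.mpr fun h => by
      simpa [hpre.self q hq] using hqp h
    exact ENNReal.tsum_eq_zero.mp ((hextP p hp A hA).symm.trans h0) ⟨q, hq, hpos⟩
  · rintro _ ⟨p, hp, rfl⟩
    obtain ⟨_, ⟨f, l, hf, hl, rfl⟩, hac⟩ := hpre.ps p hp
    refine ⟨_, ⟨fun k => extQ (f k), l, fun k => ⟨f k, hf k, rfl⟩, hl, rfl⟩,
      Measure.AbsolutelyContinuous.mk fun A hA h0 => ?_⟩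
    refine (hextP p hp A hA).trans (ENNReal.tsum_eq_zero.mpr fun q => hac ?_)
    refine Measure.sum_apply_eq_zero.mpr fun k => ?_
    by_cases hk : f k = q
    · have hk0 := Measure.sum_apply_eq_zero.mp h0 k
      rw [Measure.smul_apply] at hk0 ⊢
      rw [← hk, ← hextQ (f k) (hf k) A hA]
      exact hk0
    · rw [Measure.smul_apply, measure_mono_null inter_subset_right
        (hpre.other (f k) (hf k) q q.2.1 hk), smul_zero]
  · exact hU E hE
  · rw [sdiff_eq_empty.mpr (subset_biUnion_of_mem (u := E) hq)]
    exact measure_empty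
  · rw [hextQ q hq _ ((hU E hE).diff hF), inter_comm, ← inter_sdiff_assoc, inter_comm,
      biUnion_inter_of_disjoint hdisj (fun r hr => (hE r hr).2) hq]
    have h0 := hEF q hq
    rwa [hextQ q hq _ ((hE q hq).1.diff hF),
      inter_eq_left.mpr (sdiff_subset.trans (hE q hq).2)] at h0
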